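/- arXiv:1009.4741 — 4 statements merged into one kernel-verified Lean document; each statement's English description precedes it below -/
import Mathlib

section
/- Fix c, d ∈ [0,1] and define f_{c,d}(a,b) := a·c + b·d − max(0, a + b − 1)·max(0, c + d − 1) for a, b ∈ [0,1]. Then f_{c,d} is concave on [0,1]²: for all γ, a, b, a', b' ∈ [0,1], γ·f_{c,d}(a,b) + (1 − γ)·f_{c,d}(a',b') ≤ f_{c,d}(γ·a + (1 − γ)·a', γ·b + (1 − γ)·b'). -/
theorem stmt_7 (c d : ℝ) (hc : c ∈ Set.Icc (0:ℝ) 1) (hd : d ∈ Set.Icc (0:ℝ) 1)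
    (f : ℝ → ℝ → ℝ)
    (hf : ∀ a b, f a b = a * c + b * d - max 0 (a + b - 1) * max 0 (c + d - 1)) :
    ∀ γ a b a' b' : ℝ, γ ∈ Set.Icc (0:ℝ) 1 → a ∈ Set.Icc (0:ℝ) 1 →
      b ∈ Set.Icc (0:ℝ) 1 → a' ∈ Set.Icc (0:ℝ) 1 → b' ∈ Set.Icc (0:ℝ) 1 →
      γ * f a b + (1 - γ) * f a' b' ≤ f (γ * a + (1 - γ) * a') (γ * b + (1 - γ) * b') := by
  intro γ a b a' b' hγ _ _ _ _
  have hmax : max 0 (γ * a + (1 - γ) * a' + (γ * b + (1 - γ) * b') - 1) ≤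
      γ * max 0 (a + b - 1) + (1 - γ) * max 0 (a' + b' - 1) := by
    have hγ' : 0 ≤ 1 - γ := sub_nonneg.mpr hγ.2
    refine max_le (add_nonneg (mul_nonneg hγ.1 (le_max_left _ _))
      (mul_nonneg hγ' (le_max_left _ _))) ?_
    linarith [mul_le_mul_of_nonneg_left (le_max_right 0 (a + b - 1)) hγ.1,
      mul_le_mul_of_nonneg_left (le_max_right 0 (a' + b' - 1)) hγ']
  simp only [hf]
  linarith [mul_le_mul_of_nonneg_right hmax (le_max_left 0 (c + d - 1))]
end

section
/- Let M be a nonempty finite index set, let r : M → [0,1] with ∑_{i∈M} r_i = 1, and for each i ∈ M let p^i_{00}, p^i_{11}, p^i_{0s}, p^i_{1s}, p^i_{s0}, p^i_{s1} ∈ [0,1] satisfy: p^i_{00} ≤ p^i_{0s}·p^i_{s0}, p^i_{11} ≤ p^i_{1s}·p^i_{s1}, and p^i_{00} + p^i_{11} ≤ p^i_{0s}·p^i_{s0} + p^i_{1s}·p^i_{s1} − max(0, p^i_{0s} + p^i_{1s} − 1)·max(0, p^i_{s0} + p^i_{s1} − 1). Define p_{00} := ∑_i r_i·p^i_{00}, p_{11}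 := ∑_i r_i·p^i_{11}, p_{0s} := ∑_i r_i·p^i_{0s}, p_{1s} := ∑_i r_i·p^i_{1s}, p_{s0} := max_{i∈M} p^i_{s0}, and p_{s1} := max_{i∈M} p^i_{s1}. Then p_{00} ≤ p_{0s}·p_{s0}, p_{11} ≤ p_{1s}·p_{s1}, and p_{00} + p_{11} ≤ p_{0s}·p_{s0} + p_{1s}·p_{s1} − max(0, p_{0s} + p_{1s} − 1)·max(0, p_{s0} + p_{s1} − 1). -/
/-- The classical coin-flipping bound is monotone in the last two parameters. -/
theorem coinFlip_bound_mono {a b x y X Y : ℝ} (ha : a ∈ Set.Icc (0:ℝ) 1)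
    (hb : b ∈ Set.Icc (0:ℝ) 1) (hx : x ≤ X) (hy : y ≤ Y) :
    a * x + b * y - max 0 (a + b - 1) * max 0 (x + y - 1) ≤
      a * X + b * Y - max 0 (a + b - 1) * max 0 (X + Y - 1) := by
  obtain ⟨ha0, ha1⟩ := ha
  obtain ⟨hb0, hb1⟩ := hb
  have hm0 : 0 ≤ max 0 (a + b - 1) := le_max_left _ _
  have hma : max 0 (a + b - 1) ≤ a := max_le ha0 (by linarith)
  have hmb : max 0 (a + b - 1) ≤ b := max_le hb0 (by linarith)
  have hd : max 0 (X + Y - 1) ≤ max 0 (x + y - 1) + ((X - x) + (Y - y)) :=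
    max_le (by linarith [le_max_left 0 (x + y - 1)]) (by linarith [le_max_right 0 (x + y - 1)])
  have h1 := mul_le_mul_of_nonneg_left hd hm0
  have h2 := mul_le_mul_of_nonneg_right hma (sub_nonneg.2 hx)
  have h3 := mul_le_mul_of_nonneg_right hmb (sub_nonneg.2 hy)
  linarith

theorem stmt_9 {M : Type*} [Fintype M] [Nonempty M]
    (r p00 p11 p0s p1s ps0 ps1 : M → ℝ)
    (hr : ∀ i, r i ∈ Set.Icc (0:ℝ) 1) (hrsum : ∑ i, r i = 1)
    (h00 : ∀ i, p00 i ∈ Set.Icc (0:ℝ) 1) (h11 : ∀ i, p11 i ∈ Set.Icc (0:ℝ) 1)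
    (h0s : ∀ i, p0s i ∈ Set.Icc (0:ℝ) 1) (h1s : ∀ i, p1s i ∈ Set.Icc (0:ℝ) 1)
    (hs0 : ∀ i, ps0 i ∈ Set.Icc (0:ℝ) 1) (hs1 : ∀ i, ps1 i ∈ Set.Icc (0:ℝ) 1)
    (hb0 : ∀ i, p00 i ≤ p0s i * ps0 i)
    (hb1 : ∀ i, p11 i ≤ p1s i * ps1 i)
    (hb2 : ∀ i, p00 i + p11 i ≤ p0s i * ps0 i + p1s i * ps1 i -
      max 0 (p0s i + p1s i - 1) * max 0 (ps0 i + ps1 i - 1))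
    (P00 P11 P0s P1s Ps0 Ps1 : ℝ)
    (hP00 : P00 = ∑ i, r i * p00 i) (hP11 : P11 = ∑ i, r i * p11 i)
    (hP0s : P0s = ∑ i, r i * p0s i) (hP1s : P1s = ∑ i, r i * p1s i)
    (hPs0 : Ps0 = Finset.univ.sup' Finset.univ_nonempty ps0)
    (hPs1 : Ps1 = Finset.univ.sup' Finset.univ_nonempty ps1) :
    P00 ≤ P0s * Ps0 ∧ P11 ≤ P1s * Ps1 ∧
      P00 + P11 ≤ P0s * Ps0 + P1s * Ps1 -
        max 0 (P0s + P1s - 1) * max 0 (Ps0 + Ps1 - 1) := by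
  have hx : ∀ i, ps0 i ≤ Ps0 := fun i => hPs0 ▸ Finset.le_sup' ps0 (Finset.mem_univ i)
  have hy : ∀ i, ps1 i ≤ Ps1 := fun i => hPs1 ▸ Finset.le_sup' ps1 (Finset.mem_univ i)
  refine ⟨?_, ?_, ?_⟩
  · rw [hP00, hP0s, Finset.sum_mul]
    refine Finset.sum_le_sum fun i _ => ?_
    rw [mul_assoc]
    exact mul_le_mul_of_nonneg_left
      ((hb0 i).trans (mul_le_mul_of_nonneg_left (hx i) (h0s i).1)) (hr i).1
  · rw [hP11, hP1s, Finset.sum_mul]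
    refine Finset.sum_le_sum fun i _ => ?_
    rw [mul_assoc]
    exact mul_le_mul_of_nonneg_left
      ((hb1 i).trans (mul_le_mul_of_nonneg_left (hy i) (h1s i).1)) (hr i).1
  · have hjensen : max 0 (P0s + P1s - 1) ≤ ∑ i, r i * max 0 (p0s i + p1s i - 1) := by
      refine max_le (Finset.sum_nonneg fun i _ => mul_nonneg (hr i).1 (le_max_left _ _)) ?_
      rw [hP0s, hP1s, ← hrsum, ← Finset.sum_add_distrib, ← Finset.sum_sub_distrib]
      refine Finset.sum_le_sum fun i _ => ?_
      rw [hrsum]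
      linarith [mul_le_mul_of_nonneg_left (le_max_right 0 (p0s i + p1s i - 1)) (hr i).1]
    have hsum : ∑ i, r i * (p00 i + p11 i) ≤ ∑ i, r i * (p0s i * Ps0 + p1s i * Ps1 -
        max 0 (p0s i + p1s i - 1) * max 0 (Ps0 + Ps1 - 1)) :=
      Finset.sum_le_sum fun i _ => mul_le_mul_of_nonneg_left
        ((hb2 i).trans (coinFlip_bound_mono (h0s i) (h1s i) (hx i) (hy i))) (hr i).1
    simp only [mul_add, mul_sub, ← mul_assoc, Finset.sum_add_distrib, Finset.sum_sub_distrib,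
      ← Finset.sum_mul] at hsum
    rw [← hP00, ← hP11, ← hP0s, ← hP1s] at hsum
    linarith [mul_le_mul_of_nonneg_right hjensen (le_max_left 0 (Ps0 + Ps1 - 1))]
end

section
/- Let p0s, p1s, ps0, ps1 ∈ [0,1] with ps0 + ps1 > 1 and p0s·ps0 + p1s·ps1 = 1. With x := (p0s·ps0 + ps1 − 1)/(ps0 + ps1 − 1), z0 := (ps0 + ps1 − 1)/ps1, z1 := (ps0 + ps1 − 1)/ps0, p0 := 1 − ps1 and p1 := 1 − ps0, it holds that x·z0 + x·(1 − z0)·p0 + (1 − x)·(1 − z1)·(1 − p1) = p0s·ps0, and hence 1 − (x·z0 + x·(1 − z0)·p0 + (1 − x)·(1 − z1)·(1 − p1)) = p1s·ps1. -/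
theorem stmt_15 (p0s p1s ps0 ps1 : ℝ)
    (h0s : p0s ∈ Set.Icc (0:ℝ) 1) (h1s : p1s ∈ Set.Icc (0:ℝ) 1)
    (hs0 : ps0 ∈ Set.Icc (0:ℝ) 1) (hs1 : ps1 ∈ Set.Icc (0:ℝ) 1)
    (hgt : ps0 + ps1 > 1) (hopt : p0s * ps0 + p1s * ps1 = 1)
    (x z0 z1 p0 p1 : ℝ)
    (hx : x = (p0s * ps0 + ps1 - 1) / (ps0 + ps1 - 1))
    (hz0 : z0 = (ps0 + ps1 - 1) / ps1) (hz1 : z1 = (ps0 + ps1 - 1) / ps0)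
    (hp0 : p0 = 1 - ps1) (hp1 : p1 = 1 - ps0) :
    x * z0 + x * (1 - z0) * p0 + (1 - x) * (1 - z1) * (1 - p1) = p0s * ps0 ∧
    1 - (x * z0 + x * (1 - z0) * p0 + (1 - x) * (1 - z1) * (1 - p1)) = p1s * ps1 := by
  have hs0_pos : 0 < ps0 := by linarith [hs1.2]
  have hs1_pos : 0 < ps1 := by linarith [hs0.2]
  have hxD : x * (ps0 + ps1 - 1) = p0s * ps0 + ps1 - 1 := by
    rw [hx, div_mul_cancel₀ _ (by linarith)]
  have hA : z0 + (1 - z0) * p0 = ps0 := by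
    rw [hz0, hp0]
    field_simp
    ring
  have hB : (1 - z1) * (1 - p1) = 1 - ps1 := by
    rw [hz1, hp1]
    field_simp
    ring
  have hprob : x * z0 + x * (1 - z0) * p0 + (1 - x) * (1 - z1) * (1 - p1) = p0s * ps0 := by
    linear_combination x * hA + (1 - x) * hB + hxD
  exact ⟨hprob, by linarith⟩
end

section
/- Let a ∈ [0, 1/2] and p ∈ [0,1]. Then the two conditions (1 − a)/2 ≤ p² and 1 − a ≤ 2·p² − (max(0, 2p − 1))² hold if and only if p ≥ 1 − √(a/2). -/
theorem stmt_17 (a p : ℝ) (ha : a ∈ Set.Icc (0:ℝ) (1/2)) (hp : p ∈ Set.Icc (0:ℝ) 1) :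
    ((1 - a) / 2 ≤ p ^ 2 ∧ 1 - a ≤ 2 * p ^ 2 - (max 0 (2 * p - 1)) ^ 2)
    ↔ p ≥ 1 - Real.sqrt (a / 2) := by
  obtain ⟨ha0, ha1⟩ := ha
  obtain ⟨hp0, hp1⟩ := hp
  constructor
  · rintro ⟨h1, h2⟩
    have hp2 : 1 / 2 ≤ p := by nlinarith
    rw [max_eq_right (by linarith)] at h2
    have : 1 - p ≤ Real.sqrt (a / 2) := Real.le_sqrt_of_sq_le (by nlinarith)
    linarith
  · intro h
    have hs : Real.sqrt (a / 2) ≤ 1 / 2 := Real.sqrt_le_iff.mpr ⟨by norm_num, by linarith⟩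
    have hsq : (1 - p) ^ 2 ≤ a / 2 :=
      (Real.le_sqrt (by linarith) (by linarith)).mp (by linarith)
    rw [max_eq_right (by linarith)]
    constructor <;> nlinarith [sq_nonneg (2 * p - 1)]
end
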